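/- Capped directed hyperedge cut functions are submodular: For a directed hyperedge (U, v) with U ⊆ V, v ∉ U, and a cap p ∈ ℕ, the function f(S) = min{|U ∩ S|, p} if v ∉ S, and f(S) = 0 if v ∈ S, is submodular on V. -/

import Mathlib

open Finset

/-- The cut function of a single directed hyperedge `(U, v)` with cap `p`,
`f(S) = min{|U ∩ S|, p}` if `v ∉ S` and `f(S) = 0` otherwise, is submodular. -/
theorem stmt16 {V : Type*} [DecidableEq V]
    (U : Finset V) (v : V) (hv : v ∉ U) (p : ℕ)
    (f : Finset V → ℕ)
    (hf : ∀ S, f S = if v ∈ S then 0 else min (U ∩ S).card p) :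
    ∀ A B : Finset V, f (A ∪ B) + f (A ∩ B) ≤ f A + f B := by
  intro A B
  have h1 : (U ∩ (A ∪ B)).card + (U ∩ (A ∩ B)).card = (U ∩ A).card + (U ∩ B).card := by
    rw [Finset.inter_union_distrib_left, Finset.inter_inter_distrib_left]
    exact Finset.card_union_add_card_inter _ _
  have h2 : (U ∩ (A ∩ B)).card ≤ (U ∩ A).card :=
    Finset.card_le_card (Finset.inter_subset_inter_left Finset.inter_subset_left)
  have h3 : (U ∩ (A ∩ B)).card ≤ (U ∩ B).card :=
    Finset.card_le_card (Finset.inter_subset_inter_left Finset.inter_subset_right)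
  rw [hf, hf, hf, hf]
  by_cases hA : v ∈ A <;> by_cases hB : v ∈ B <;>
    simp only [Finset.mem_union, Finset.mem_inter, hA, hB, or_true, true_or, or_false, and_true,
      true_and, and_false, false_and, if_true, if_false, or_self, and_self] <;> omega
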